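/- arXiv:2405.02441 — 2 statements merged into one kernel-verified Lean document; each statement's English description precedes it below -/
import Mathlib

section
/- Let y ~ N(μ, Σ) be n-dimensional Gaussian with Σ positive definite, and let η ∈ (0,1). Among all ellipsoids E(μ', C) with Pr[y ∈ E(μ', C)] ≥ η, the ellipsoid E(μ, F^{-1}_{χ²_n}(η)·Σ) has minimal volume, and any ellipsoid achieving the minimal volume and satisfying the constraint must equal E(μ, F^{-1}_{χ²_n}(η)·Σ). -/
open MeasureTheory Matrix ENNReal

noncomputable def ellipsoid {n : ℕ} (μ : Fin n → ℝ) (C : Matrix (Fin n) (Fin n) ℝ) :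
    Set (Fin n → ℝ) :=
  {y | (y - μ) ⬝ᵥ (C⁻¹ *ᵥ (y - μ)) ≤ 1}

/-- The density of the multivariate Gaussian `N(μ, S)` on `ℝ^n`. -/
noncomputable def gaussianPdf {n : ℕ} (μ : Fin n → ℝ) (S : Matrix (Fin n) (Fin n) ℝ)
    (y : Fin n → ℝ) : ℝ :=
  ((2 * Real.pi) ^ n * S.det) ^ (-(1 : ℝ) / 2) *
    Real.exp (-(1 / 2) * ((y - μ) ⬝ᵥ (S⁻¹ *ᵥ (y - μ))))

/-- The multivariate Gaussian measure `N(μ, S)` on `ℝ^n`. -/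
noncomputable def gaussianMeasure {n : ℕ} (μ : Fin n → ℝ) (S : Matrix (Fin n) (Fin n) ℝ) :
    Measure (Fin n → ℝ) :=
  volume.withDensity fun y => ENNReal.ofReal (gaussianPdf μ S y)

/-- The chi-square distribution with `n` degrees of freedom. -/
noncomputable def chiSquareMeasure (n : ℕ) : Measure ℝ :=
  ProbabilityTheory.gammaMeasure ((n : ℝ) / 2) (1 / 2)

/-- The CDF of the chi-square distribution with `n` degrees of freedom. -/
noncomputable def chiSquareCDF (n : ℕ) (t : ℝ) : ℝ := (chiSquareMeasure n (Set.Iic t)).toReal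

/-- The quantile function (generalized inverse CDF) of the chi-square distribution. -/
noncomputable def chiSquareQuantile (n : ℕ) (η : ℝ) : ℝ :=
  sInf {t : ℝ | η ≤ chiSquareCDF n t}

open ProbabilityTheory

/-- Under the standard Gaussian density on `ℝ^n`, the squared norm is chi-square distributed. -/
lemma integral_gaussian_mul_comp_sq_norm {n : ℕ} (hn : 0 < n) (h : ℝ → ℝ) :
    ∫ x : EuclideanSpace ℝ (Fin n),
        ((2 * Real.pi) ^ n : ℝ) ^ (-(1 : ℝ) / 2) * Real.exp (-(1 / 2) * ‖x‖ ^ 2) * h (‖x‖ ^ 2) =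
      ∫ u, gammaPDFReal ((n : ℝ) / 2) (1 / 2) u * h u := by
  have : Nonempty (Fin n) := ⟨⟨0, hn⟩⟩
  have hn' : (0 : ℝ) < n := by exact_mod_cast hn
  have hΓ : 0 < Real.Gamma ((n : ℝ) / 2) := Real.Gamma_pos_of_pos (by positivity)
  have hball : volume.real (Metric.ball (0 : EuclideanSpace ℝ (Fin n)) 1) =
      √Real.pi ^ n / Real.Gamma ((n : ℝ) / 2 + 1) := by
    have : 0 < Real.Gamma ((n : ℝ) / 2 + 1) := Real.Gamma_pos_of_pos (by positivity)
    rw [measureReal_def, EuclideanSpace.volume_ball]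
    simp only [ENNReal.ofReal_one, one_pow, one_mul, Fintype.card_fin]
    exact ENNReal.toReal_ofReal (by positivity)
  have hconst : (n : ℝ) * (√Real.pi ^ n / Real.Gamma ((n : ℝ) / 2 + 1)) *
      ((2 * Real.pi) ^ n : ℝ) ^ (-(1 : ℝ) / 2) =
      2 * ((1 / 2 : ℝ) ^ ((n : ℝ) / 2) / Real.Gamma ((n : ℝ) / 2)) := by
    rw [Real.Gamma_add_one (by positivity)]
    have h1 : ((2 * Real.pi) ^ n : ℝ) ^ (-(1 : ℝ) / 2) =
        (1 / 2 : ℝ) ^ ((n : ℝ) / 2) * (√Real.pi ^ n)⁻¹ := by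
      rw [mul_pow, Real.mul_rpow (by positivity) (by positivity), ← Real.rpow_natCast 2,
        ← Real.rpow_natCast Real.pi, ← Real.rpow_mul (by positivity),
        ← Real.rpow_mul Real.pi_pos.le, Real.sqrt_eq_rpow, ← Real.rpow_natCast,
        ← Real.rpow_mul Real.pi_pos.le, one_div, Real.inv_rpow (by positivity),
        ← Real.rpow_neg (by positivity), ← Real.rpow_neg Real.pi_pos.le]
      congr 2 <;> ring
    rw [h1]
    have : √Real.pi ^ n ≠ 0 := by positivity
    field_simp
  have hR : ∫ u, gammaPDFReal ((n : ℝ) / 2) (1 / 2) u * h u =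
      ∫ u in Set.Ioi (0 : ℝ), gammaPDFReal ((n : ℝ) / 2) (1 / 2) u * h u := by
    rw [← integral_Ici_eq_integral_Ioi, ← integral_indicator measurableSet_Ici]
    congr 1 with u
    by_cases hu : 0 ≤ u <;> simp [gammaPDFReal, hu]
  rw [hR, ← integral_comp_rpow_Ioi_of_pos (p := 2) (by norm_num),
    integral_fun_norm_addHaar volume (fun r => ((2 * Real.pi) ^ n : ℝ) ^ (-(1 : ℝ) / 2) *
      Real.exp (-(1 / 2) * r ^ 2) * h (r ^ 2)), hball, finrank_euclideanSpace, Fintype.card_fin,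
    nsmul_eq_mul, smul_eq_mul, ← mul_assoc, ← integral_const_mul]
  refine setIntegral_congr_fun measurableSet_Ioi fun r hr => ?_
  have hr : 0 < r := hr
  have hpow : r * (r ^ 2) ^ ((n : ℝ) / 2 - 1) = r ^ (n - 1) := by
    have hadd := Real.rpow_add hr 1 (2 * ((n : ℝ) / 2 - 1))
    rw [Real.rpow_one, Real.rpow_mul hr.le] at hadd
    rw [← Real.rpow_natCast r 2, Nat.cast_ofNat, ← hadd, ← Real.rpow_natCast r (n - 1),
      Nat.cast_sub hn]
    congr 1
    push_cast
    ring
  have h2 : r ^ (2 : ℝ) = r ^ 2 := by exact_mod_cast Real.rpow_natCast r 2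
  have h3 : r ^ ((2 : ℝ) - 1) = r := by norm_num
  simp only [smul_eq_mul, h2, h3, gammaPDFReal, sq_nonneg, if_true, ← hpow]
  rw [show -(1 / 2 * r ^ 2) = -(1 / 2) * r ^ 2 by ring]
  linear_combination (r * (r ^ 2) ^ ((n : ℝ) / 2 - 1) * Real.exp (-(1 / 2) * r ^ 2) * h (r ^ 2)) *
    hconst

/-- The standard Gaussian mass of a Euclidean ball is given by the chi-square CDF. -/
lemma lintegral_gaussian_sq_norm_le {n : ℕ} (hn : 0 < n) (t : ℝ) :
    ∫⁻ x : EuclideanSpace ℝ (Fin n), {x : EuclideanSpace ℝ (Fin n) | ‖x‖ ^ 2 ≤ t}.indicator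
      (fun x => ENNReal.ofReal (((2 * Real.pi) ^ n : ℝ) ^ (-(1 : ℝ) / 2) *
        Real.exp (-(1 / 2) * ‖x‖ ^ 2))) x = chiSquareMeasure n (Set.Iic t) := by
  have hn' : (0 : ℝ) < n := by exact_mod_cast hn
  have hpdf : ∀ u, 0 ≤ gammaPDFReal ((n : ℝ) / 2) (1 / 2) u :=
    gammaPDFReal_nonneg (by positivity) (by norm_num)
  have hpdf_one : ∫ u, gammaPDFReal ((n : ℝ) / 2) (1 / 2) u = 1 := by
    rw [integral_eq_lintegral_of_nonneg_ae (ae_of_all _ hpdf) (by fun_prop)]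
    exact (congrArg ENNReal.toReal
      (lintegral_gammaPDF_eq_one (by positivity) (by norm_num))).trans (by simp)
  have hint : Integrable (fun x : EuclideanSpace ℝ (Fin n) =>
      ((2 * Real.pi) ^ n : ℝ) ^ (-(1 : ℝ) / 2) * Real.exp (-(1 / 2) * ‖x‖ ^ 2)) := by
    apply integrable_of_integral_eq_one
    simpa only [mul_one, hpdf_one] using integral_gaussian_mul_comp_sq_norm hn (fun _ => 1)
  have hmeas : MeasurableSet {x : EuclideanSpace ℝ (Fin n) | ‖x‖ ^ 2 ≤ t} :=
    measurableSet_le (by fun_prop) measurable_const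
  rw [lintegral_indicator hmeas, ← ofReal_integral_eq_lintegral_ofReal hint.integrableOn
    (ae_of_all _ fun x => by positivity), ← integral_indicator hmeas]
  have key := integral_gaussian_mul_comp_sq_norm hn ((Set.Iic t).indicator fun _ => 1)
  rw [chiSquareMeasure, gammaMeasure, withDensity_apply _ measurableSet_Iic]
  unfold gammaPDF
  rw [← ofReal_integral_eq_lintegral_ofReal
    (integrable_of_integral_eq_one hpdf_one).integrableOn (ae_of_all _ hpdf),
    ← integral_indicator measurableSet_Iic]
  congr 1
  convert! key using 2
  · ext x
    by_cases hx : ‖x‖ ^ 2 ≤ t <;> simp [Set.indicator, hx]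
  · ext x
    by_cases hx : x ≤ t <;> simp [Set.indicator, hx]

/-- A positive definite quadratic form is a Euclidean squared norm in suitable coordinates. -/
lemma Matrix.PosDef.exists_dotProduct_mulVec_eq {n : ℕ} {P : Matrix (Fin n) (Fin n) ℝ}
    (hP : P.PosDef) : ∃ B : Matrix (Fin n) (Fin n) ℝ, P.det = B.det ^ 2 ∧
      ∀ v, v ⬝ᵥ (P *ᵥ v) = ‖WithLp.toLp 2 (B *ᵥ v)‖ ^ 2 := by
  obtain ⟨B, hB, hPB⟩ : ∃ B : Matrix (Fin n) (Fin n) ℝ, IsUnit B ∧ P = star B * B := by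
    open scoped MatrixOrder Matrix.Norms.L2Operator in
    exact CStarAlgebra.isStrictlyPositive_iff_eq_star_mul_self.1 hP.isStrictlyPositive
  rw [star_eq_conjTranspose, conjTranspose_eq_transpose_of_trivial] at hPB
  refine ⟨B, by rw [hPB, det_mul, det_transpose, sq], fun v => ?_⟩
  rw [EuclideanSpace.norm_sq_eq, hPB, ← mulVec_mulVec, dotProduct_mulVec, vecMul_transpose]
  simp [dotProduct, sq]

lemma gaussianMeasure_quadratic_le {n : ℕ} (hn : 0 < n) (μ : Fin n → ℝ)
    {S : Matrix (Fin n) (Fin n) ℝ} (hS : S.PosDef) (t : ℝ) :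
    gaussianMeasure μ S {y | (y - μ) ⬝ᵥ (S⁻¹ *ᵥ (y - μ)) ≤ t} = chiSquareMeasure n (Set.Iic t) := by
  obtain ⟨B, hdet, hB⟩ := hS.inv.exists_dotProduct_mulVec_eq
  have hSdet := hS.det_pos
  have hBdet : B.det ≠ 0 := by
    rintro h
    have := hS.inv.det_pos
    simp [hdet, h] at this
  have hSB : S.det = (B.det ^ 2)⁻¹ := by
    rw [← hdet, det_nonsing_inv, Ring.inverse_eq_inv', inv_inv]
  set G : (Fin n → ℝ) → ENNReal := fun x =>
    {x : EuclideanSpace ℝ (Fin n) | ‖x‖ ^ 2 ≤ t}.indicator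
      (fun x => ENNReal.ofReal (((2 * Real.pi) ^ n : ℝ) ^ (-(1 : ℝ) / 2) *
        Real.exp (-(1 / 2) * ‖x‖ ^ 2))) (WithLp.toLp 2 x) with hG
  have hindmeas : Measurable ({x : EuclideanSpace ℝ (Fin n) | ‖x‖ ^ 2 ≤ t}.indicator
      (fun x => ENNReal.ofReal (((2 * Real.pi) ^ n : ℝ) ^ (-(1 : ℝ) / 2) *
        Real.exp (-(1 / 2) * ‖x‖ ^ 2)))) :=
    Measurable.indicator (by fun_prop) (measurableSet_le (by fun_prop) measurable_const)
  have hGmeas : Measurable G := hindmeas.comp (PiLp.volume_preserving_toLp (Fin n)).measurable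
  have hset : MeasurableSet {y | (y - μ) ⬝ᵥ (S⁻¹ *ᵥ (y - μ)) ≤ t} :=
    (isClosed_le (by fun_prop) continuous_const).measurableSet
  have hfac : ((2 * Real.pi) ^ n * S.det) ^ (-(1 : ℝ) / 2) =
      |B.det| * ((2 * Real.pi) ^ n : ℝ) ^ (-(1 : ℝ) / 2) := by
    rw [Real.mul_rpow (by positivity) hSdet.le, mul_comm, hSB, ← sq_abs, ← inv_pow,
      ← Real.rpow_natCast, ← Real.rpow_mul (by positivity)]
    norm_num [Real.rpow_neg_one]
  have hpt : ∀ y, {y | (y - μ) ⬝ᵥ (S⁻¹ *ᵥ (y - μ)) ≤ t}.indicator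
      (fun y => ENNReal.ofReal (gaussianPdf μ S y)) y =
      ENNReal.ofReal |B.det| * G (toLin' B (y - μ)) := by
    intro y
    simp only [hG, Set.indicator, Set.mem_ofPred_eq, toLin'_apply, ← hB, gaussianPdf, hfac]
    split_ifs
    · rw [mul_assoc, ENNReal.ofReal_mul (abs_nonneg _)]
    · simp
  rw [gaussianMeasure, withDensity_apply _ hset, ← lintegral_indicator hset]
  simp_rw [hpt]
  rw [lintegral_sub_right_eq_self (fun y => ENNReal.ofReal |B.det| * G (toLin' B y)) μ,
    lintegral_const_mul' _ _ ENNReal.ofReal_ne_top,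
    ← lintegral_map hGmeas (LinearMap.continuous_of_finiteDimensional _).measurable,
    Real.map_matrix_volume_pi_eq_smul_volume_pi hBdet, lintegral_smul_measure, smul_eq_mul,
    ← mul_assoc, ← ENNReal.ofReal_mul (abs_nonneg _), ← abs_mul, mul_inv_cancel₀ hBdet, abs_one,
    ENNReal.ofReal_one, one_mul, hG,
    (PiLp.volume_preserving_toLp (Fin n)).lintegral_comp hindmeas,
    lintegral_gaussian_sq_norm_le hn]

lemma chiSquare_measure_Iic_quantile {n : ℕ} (hn : 0 < n) {η : ℝ} (hη : η ∈ Set.Ioo (0 : ℝ) 1) :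
    0 < chiSquareQuantile n η ∧
      chiSquareMeasure n (Set.Iic (chiSquareQuantile n η)) = ENNReal.ofReal η := by
  have hn' : (0 : ℝ) < n := by exact_mod_cast hn
  have : IsProbabilityMeasure (chiSquareMeasure n) :=
    isProbabilityMeasure_gammaMeasure (by positivity) (by norm_num)
  have hF : ∀ t, chiSquareCDF n t = cdf (chiSquareMeasure n) t := fun t =>
    (cdf_eq_real _ t).symm
  have hF0 : ∀ t ≤ 0, chiSquareCDF n t = 0 := by
    intro t ht
    have : chiSquareMeasure n (Set.Iic t) = 0 := by
      rw [chiSquareMeasure, gammaMeasure, withDensity_apply _ measurableSet_Iic,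
        setLIntegral_congr Iio_ae_eq_Iic.symm, lintegral_gammaPDF_of_nonpos ht]
    simp [chiSquareCDF, this]
  set A := {t : ℝ | η ≤ chiSquareCDF n t} with hA
  have hbdd : BddBelow A := ⟨0, fun t ht => by
    by_contra! h
    have ht : η ≤ chiSquareCDF n t := ht
    rw [hF0 t h.le] at ht
    exact absurd hη.1 (not_lt.2 ht)⟩
  have hne : A.Nonempty := by
    obtain ⟨t, ht⟩ := ((tendsto_cdf_atTop (chiSquareMeasure n)).eventually
      (lt_mem_nhds hη.2)).exists
    exact ⟨t, by rw [hA, Set.mem_ofPred_eq, hF]; exact ht.le⟩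
  set q := chiSquareQuantile n η with hq
  have hqA : η ≤ chiSquareCDF n q := by
    rw [hF]
    have hrc : Filter.Tendsto (cdf (chiSquareMeasure n)) (nhdsWithin q (Set.Ioi q))
        (nhds (cdf (chiSquareMeasure n) q)) :=
      ((cdf (chiSquareMeasure n)).right_continuous q).mono_left
        (nhdsWithin_mono _ Set.Ioi_subset_Ici_self)
    refine ge_of_tendsto hrc ?_
    filter_upwards [self_mem_nhdsWithin] with t ht
    obtain ⟨s, hs, hst⟩ := (csInf_lt_iff hbdd hne).1 (show sInf A < t from ht)
    have hs : η ≤ chiSquareCDF n s := hs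
    rw [hF] at hs
    exact hs.trans (monotone_cdf _ hst.le)
  have hqpos : 0 < q := by
    by_contra! h
    rw [hF0 q h] at hqA
    exact absurd hη.1 (not_lt.2 hqA)
  refine ⟨hqpos, le_antisymm ?_ ?_⟩
  · have hIio : chiSquareMeasure n (Set.Iic q) = chiSquareMeasure n (Set.Iio q) := by
      rw [chiSquareMeasure, gammaMeasure]
      exact measure_congr ((withDensity_absolutelyContinuous _ _).ae_le Iio_ae_eq_Iic.symm)
    obtain ⟨u, hu, hult, hut⟩ := exists_seq_strictMono_tendsto q
    have hun : Set.Iio q = ⋃ k, Set.Iic (u k) := by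
      ext x
      simp only [Set.mem_Iio, Set.mem_iUnion, Set.mem_Iic]
      refine ⟨fun hx => ?_, fun ⟨k, hk⟩ => hk.trans_lt (hult k)⟩
      obtain ⟨k, hk⟩ := (hut.eventually (lt_mem_nhds hx)).exists
      exact ⟨k, hk.le⟩
    have hmono : Monotone fun k => Set.Iic (u k) := fun i j hij =>
      Set.Iic_subset_Iic.2 (hu.monotone hij)
    rw [hIio, hun, hmono.measure_iUnion]
    refine iSup_le fun k => ?_
    rw [← ofReal_cdf]
    apply ENNReal.ofReal_le_ofReal
    rw [← hF]
    by_contra! h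
    exact absurd (csInf_le hbdd (show u k ∈ A from h.le)) (not_le.2 (hult k))
  · rw [← ofReal_cdf, ← hF]
    exact ENNReal.ofReal_le_ofReal hqA

/-- The bathtub principle: a superlevel set of a density has the least measure among all sets
that carry at least as much mass. -/
lemma measure_le_of_withDensity_le {α : Type*} [MeasurableSpace α] {ν : Measure α}
    {f : α → ENNReal} {c : ENNReal} (hc : c ≠ 0) (hc' : c ≠ ∞) {A B : Set α}
    (hA : MeasurableSet A) (hB : MeasurableSet B)
    (hfA : ∀ x ∈ A, c ≤ f x) (hfA' : ∀ x ∉ A, f x ≤ c) (hfin : ν.withDensity f A ≠ ∞)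
    (hAB : ν.withDensity f A ≤ ν.withDensity f B) :
    ν (A \ B) ≤ ν (B \ A) ∧ c * ν (A \ B) ≤ ν.withDensity f (B \ A) := by
  have h1 : ν.withDensity f (A \ B) ≤ ν.withDensity f (B \ A) := by
    rw [← measure_sdiff_add_inter A hB, ← measure_sdiff_add_inter B hA, Set.inter_comm B A] at hAB
    exact (ENNReal.add_le_add_iff_right
      (measure_ne_top_of_subset Set.inter_subset_left hfin)).1 hAB
  have h2 : c * ν (A \ B) ≤ ν.withDensity f (A \ B) := by
    rw [withDensity_apply _ (hA.diff hB), ← setLIntegral_const]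
    exact setLIntegral_mono' (hA.diff hB) fun x hx => hfA x hx.1
  have h3 : ν.withDensity f (B \ A) ≤ c * ν (B \ A) := by
    rw [withDensity_apply _ (hB.diff hA), ← setLIntegral_const]
    exact setLIntegral_mono' (hB.diff hA) fun x hx => hfA' x hx.2
  exact ⟨(ENNReal.mul_le_mul_iff_right hc hc').1 (h2.trans (h1.trans h3)), h2.trans h1⟩

lemma measure_le_of_measure_sdiff_le {α : Type*} [MeasurableSpace α] {ν : Measure α}
    {A B : Set α} (hA : MeasurableSet A) (hB : MeasurableSet B) (h : ν (A \ B) ≤ ν (B \ A)) :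
    ν A ≤ ν B := by
  rw [← measure_sdiff_add_inter A hB, ← measure_sdiff_add_inter B hA, Set.inter_comm B A]
  gcongr

/-- The equality case of the bathtub principle. -/
lemma measure_sdiff_eq_zero_of_withDensity_le {α : Type*} [MeasurableSpace α] {ν : Measure α}
    {f : α → ENNReal} {c : ENNReal} (hc : c ≠ 0) (hc' : c ≠ ∞) {A B : Set α}
    (hA : MeasurableSet A) (hB : MeasurableSet B)
    (hfA : ∀ x ∈ A, c ≤ f x) (hfA' : ∀ x ∉ A, f x < c) (hfin : ν.withDensity f A ≠ ∞)
    (hAB : ν.withDensity f A ≤ ν.withDensity f B) (hνA : ν A ≠ ∞) (hν : ν B = ν A) :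
    ν (A \ B) = 0 ∧ ν (B \ A) = 0 := by
  obtain ⟨-, h2⟩ := measure_le_of_withDensity_le hc hc' hA hB hfA (fun x hx => (hfA' x hx).le)
    hfin hAB
  have heq : ν (B \ A) = ν (A \ B) := by
    rw [← measure_sdiff_add_inter A hB, ← measure_sdiff_add_inter B hA, Set.inter_comm B A] at hν
    exact (ENNReal.add_left_inj (measure_ne_top_of_subset Set.inter_subset_left hνA)).1 hν
  suffices h : ν (B \ A) = 0 from ⟨heq ▸ h, h⟩
  by_contra h
  have hle : ν.withDensity f (B \ A) ≤ c * ν (B \ A) := by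
    rw [withDensity_apply _ (hB.diff hA), ← setLIntegral_const]
    exact setLIntegral_mono' (hB.diff hA) fun x hx => (hfA' x hx.2).le
  have hlt : ν.withDensity f (B \ A) < c * ν (B \ A) := by
    rw [withDensity_apply _ (hB.diff hA), ← setLIntegral_const]
    refine setLIntegral_strict_mono (hB.diff hA) h measurable_const ?_
      (ae_of_all _ fun x hx => hfA' x hx.2)
    rw [← withDensity_apply _ (hB.diff hA)]
    refine ne_top_of_le_ne_top (ENNReal.mul_ne_top hc' ?_) hle
    exact heq ▸ measure_ne_top_of_subset Set.sdiff_subset hνA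
  exact absurd h2 (not_le.2 (heq ▸ hlt))

lemma isClosed_ellipsoid {n : ℕ} (μ : Fin n → ℝ) (C : Matrix (Fin n) (Fin n) ℝ) :
    IsClosed (ellipsoid μ C) :=
  isClosed_le (by fun_prop) continuous_const

lemma ellipsoid_smul {n : ℕ} (μ : Fin n → ℝ) {S : Matrix (Fin n) (Fin n) ℝ} (hS : S.PosDef)
    {q : ℝ} (hq : 0 < q) :
    ellipsoid μ (q • S) = {y | (y - μ) ⬝ᵥ (S⁻¹ *ᵥ (y - μ)) ≤ q} := by
  have hinv : (q • S)⁻¹ = q⁻¹ • S⁻¹ := by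
    have := invertibleOfNonzero hq.ne'
    rw [inv_smul _ _ ((isUnit_iff_isUnit_det S).1 hS.isUnit), invOf_eq_inv]
  ext y
  simp only [ellipsoid, hinv, smul_mulVec, dotProduct_smul, smul_eq_mul, Set.mem_ofPred_eq,
    inv_mul_le_iff₀ hq, mul_one]

lemma Matrix.PosDef.quadratic_nonneg {n : ℕ} {P : Matrix (Fin n) (Fin n) ℝ}
    (hP : P.PosDef) (v : Fin n → ℝ) : 0 ≤ v ⬝ᵥ (P *ᵥ v) := by
  simpa using hP.posSemidef.dotProduct_mulVec_nonneg v

lemma quadratic_smul {n : ℕ} (P : Matrix (Fin n) (Fin n) ℝ) (r : ℝ) (v : Fin n → ℝ) :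
    (r • v) ⬝ᵥ (P *ᵥ (r • v)) = r ^ 2 * (v ⬝ᵥ (P *ᵥ v)) := by
  simp only [mulVec_smul, dotProduct_smul, smul_dotProduct, smul_eq_mul]
  ring

lemma ellipsoid_subset_closure_interior {n : ℕ} (μ : Fin n → ℝ)
    {C : Matrix (Fin n) (Fin n) ℝ} (hC : C.PosDef) :
    ellipsoid μ C ⊆ closure (interior (ellipsoid μ C)) := by
  intro y hy
  have hy : (y - μ) ⬝ᵥ (C⁻¹ *ᵥ (y - μ)) ≤ 1 := hy
  have hopen : IsOpen {z | (z - μ) ⬝ᵥ (C⁻¹ *ᵥ (z - μ)) < 1} :=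
    isOpen_lt (by fun_prop) continuous_const
  have hsub : {z | (z - μ) ⬝ᵥ (C⁻¹ *ᵥ (z - μ)) < 1} ⊆ interior (ellipsoid μ C) :=
    interior_maximal (fun z hz => le_of_lt (α := ℝ) hz) hopen
  refine closure_mono hsub ?_
  have hcont : Filter.Tendsto (fun r : ℝ => μ + r • (y - μ)) (nhdsWithin 1 (Set.Iio 1))
      (nhds y) := by
    have : Continuous fun r : ℝ => μ + r • (y - μ) := by fun_prop
    simpa using (this.tendsto 1).mono_left nhdsWithin_le_nhds
  refine mem_closure_of_tendsto hcont ?_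
  filter_upwards [Ioo_mem_nhdsLT (show (0 : ℝ) < 1 by norm_num)] with r hr
  have hr0 := hr.1
  have hr1 := hr.2
  simp only [add_sub_cancel_left, quadratic_smul]
  have h0 := hC.inv.quadratic_nonneg (y - μ)
  nlinarith

/-- A regular closed set contained in a closed set up to a null set is contained in it. -/
lemma subset_of_measure_sdiff_eq_zero {X : Type*} [TopologicalSpace X] [MeasurableSpace X]
    {ν : Measure X} [ν.IsOpenPosMeasure] {A B : Set X} (hB : IsClosed B)
    (hA : A ⊆ closure (interior A)) (h : ν (A \ B) = 0) : A ⊆ B := by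
  have hint : interior A \ B = ∅ :=
    (isOpen_interior.sdiff hB).measure_eq_zero_iff ν |>.1
      (measure_mono_null (Set.sdiff_subset_sdiff_left interior_subset) h)
  exact hA.trans (closure_minimal (Set.sdiff_eq_empty.1 hint) hB)

lemma ellipsoid_center_injective {n : ℕ} {μ μ' : Fin n → ℝ} {C C' : Matrix (Fin n) (Fin n) ℝ}
    (hC : C.PosDef) (h : ellipsoid μ C = ellipsoid μ' C') : μ' = μ := by
  have hrefl : ∀ (m : Fin n → ℝ) (D : Matrix (Fin n) (Fin n) ℝ) (x : Fin n → ℝ),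
      x ∈ ellipsoid m D → (2 : ℝ) • m - x ∈ ellipsoid m D := by
    intro m D x hx
    have : (2 : ℝ) • m - x - m = (-1 : ℝ) • (x - m) := by module
    simpa only [ellipsoid, Set.mem_ofPred_eq, this, quadratic_smul, neg_sq, one_pow, one_mul]
      using hx
  have htrans : ∀ k : ℕ, μ + (2 * k : ℝ) • (μ' - μ) ∈ ellipsoid μ C := by
    intro k
    induction k with
    | zero => simp [ellipsoid]
    | succ k ih =>
      have := hrefl μ' C' _ (h ▸ hrefl μ C _ ih)
      rw [← h] at this
      convert! this using 1
      push_cast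
      module
  by_contra hne
  have hpos : 0 < (μ' - μ) ⬝ᵥ (C⁻¹ *ᵥ (μ' - μ)) := by
    simpa using hC.inv.dotProduct_mulVec_pos (sub_ne_zero.2 hne)
  obtain ⟨k, hk⟩ := exists_nat_gt ((μ' - μ) ⬝ᵥ (C⁻¹ *ᵥ (μ' - μ)))⁻¹
  have hk1 : 1 < k * ((μ' - μ) ⬝ᵥ (C⁻¹ *ᵥ (μ' - μ))) := by
    rwa [inv_lt_iff_one_lt_mul₀ hpos] at hk
  have hkk := htrans k
  simp only [ellipsoid, Set.mem_ofPred_eq, add_sub_cancel_left, quadratic_smul] at hkk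
  have hk' : (1 : ℝ) ≤ k := by
    rcases Nat.eq_zero_or_pos k with rfl | hk0
    · norm_num at hk1
    · exact_mod_cast hk0
  nlinarith [mul_pos (show (0 : ℝ) < k by linarith) hpos]

lemma ellipsoid_shape_injective {n : ℕ} {μ : Fin n → ℝ} {C C' : Matrix (Fin n) (Fin n) ℝ}
    (hC : C.PosDef) (hC' : C'.PosDef) (h : ellipsoid μ C = ellipsoid μ C') : C' = C := by
  have hle : ∀ {D D' : Matrix (Fin n) (Fin n) ℝ}, D.PosDef → D'.PosDef →
      ellipsoid μ D = ellipsoid μ D' → ∀ v, v ⬝ᵥ (D'⁻¹ *ᵥ v) ≤ v ⬝ᵥ (D⁻¹ *ᵥ v) := by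
    intro D D' hD hD' hDD v
    rcases eq_or_ne v 0 with rfl | hv
    · simp
    have hpos : 0 < v ⬝ᵥ (D⁻¹ *ᵥ v) := by simpa using hD.inv.dotProduct_mulVec_pos hv
    have hmem : μ + (√(v ⬝ᵥ (D⁻¹ *ᵥ v)))⁻¹ • v ∈ ellipsoid μ D := by
      simp only [ellipsoid, Set.mem_ofPred_eq, add_sub_cancel_left, quadratic_smul, inv_pow,
        Real.sq_sqrt hpos.le]
      rw [inv_mul_cancel₀ hpos.ne']
    rw [hDD] at hmem
    simpa only [ellipsoid, Set.mem_ofPred_eq, add_sub_cancel_left, quadratic_smul, inv_pow,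
      Real.sq_sqrt hpos.le, inv_mul_le_iff₀ hpos, mul_one] using hmem
  have heq : ∀ v, v ⬝ᵥ (C⁻¹ *ᵥ v) = v ⬝ᵥ (C'⁻¹ *ᵥ v) := fun v =>
    le_antisymm (hle hC' hC h.symm v) (hle hC hC' h v)
  have hentry : ∀ (P : Matrix (Fin n) (Fin n) ℝ), P.PosDef → ∀ i j, P i j =
      ((Pi.single i 1 + Pi.single j 1) ⬝ᵥ (P *ᵥ (Pi.single i 1 + Pi.single j 1)) -
        Pi.single i 1 ⬝ᵥ (P *ᵥ Pi.single i 1) - Pi.single j 1 ⬝ᵥ (P *ᵥ Pi.single j 1)) / 2 := by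
    intro P hP i j
    have hsymm : P j i = P i j := by simpa using hP.isHermitian.apply i j
    simp [mulVec_add, hsymm]
    ring
  have hinv : C⁻¹ = C'⁻¹ := by
    ext i j
    rw [hentry _ hC.inv, hentry _ hC'.inv, heq, heq, heq]
  rw [← nonsing_inv_nonsing_inv C ((isUnit_iff_isUnit_det C).1 hC.isUnit), hinv,
    nonsing_inv_nonsing_inv C' ((isUnit_iff_isUnit_det C').1 hC'.isUnit)]

/-- Among all ellipsoids covering a Gaussian `N(μ, S)` with probability at least `η`,
the ellipsoid `E(μ, F⁻¹_{χ²_n}(η)·S)` has minimal volume, and it is the unique minimizer. -/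
theorem gaussian_minimal_volume_ellipsoid {n : ℕ} (μ : Fin n → ℝ)
    (S : Matrix (Fin n) (Fin n) ℝ) (hS : S.PosDef) (η : ℝ) (hη : η ∈ Set.Ioo (0 : ℝ) 1) :
    (ENNReal.ofReal η ≤
        gaussianMeasure μ S (ellipsoid μ (chiSquareQuantile n η • S))) ∧
      (∀ (μ' : Fin n → ℝ) (C : Matrix (Fin n) (Fin n) ℝ), C.PosDef →
        ENNReal.ofReal η ≤ gaussianMeasure μ S (ellipsoid μ' C) →
          volume (ellipsoid μ (chiSquareQuantile n η • S)) ≤ volume (ellipsoid μ' C)) ∧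
      (∀ (μ' : Fin n → ℝ) (C : Matrix (Fin n) (Fin n) ℝ), C.PosDef →
        ENNReal.ofReal η ≤ gaussianMeasure μ S (ellipsoid μ' C) →
        volume (ellipsoid μ' C) = volume (ellipsoid μ (chiSquareQuantile n η • S)) →
          μ' = μ ∧ C = chiSquareQuantile n η • S) := by
  rcases Nat.eq_zero_or_pos n with rfl | hn
  · have huniv : ∀ (m : Fin 0 → ℝ) (C : Matrix (Fin 0) (Fin 0) ℝ),
        ellipsoid m C = Set.univ := by
      intro m C
      ext y
      simp [ellipsoid]
    refine ⟨?_, fun μ' C _ _ => by simp only [huniv, le_refl],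
      fun μ' C _ _ _ => ⟨Subsingleton.elim _ _, Subsingleton.elim _ _⟩⟩
    rw [huniv, gaussianMeasure, withDensity_apply _ MeasurableSet.univ]
    simpa [gaussianPdf, volume_pi, Measure.pi_of_empty _ (0 : Fin 0 → ℝ)] using hη.2.le
  obtain ⟨hq, hqη⟩ := chiSquare_measure_Iic_quantile hn hη
  set q := chiSquareQuantile n η
  have hE := ellipsoid_smul μ hS hq
  have hmass : gaussianMeasure μ S (ellipsoid μ (q • S)) = ENNReal.ofReal η := by
    rw [hE, gaussianMeasure_quadratic_le hn μ hS, hqη]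
  have hqS : (q • S).PosDef := hS.smul hq
  have hmeas : ∀ (m : Fin n → ℝ) (C : Matrix (Fin n) (Fin n) ℝ),
      MeasurableSet (ellipsoid m C) := fun m C => (isClosed_ellipsoid m C).measurableSet
  have hk : 0 < ((2 * Real.pi) ^ n * S.det) ^ (-(1 : ℝ) / 2) := by
    have := hS.det_pos
    positivity
  set c : ENNReal := ENNReal.ofReal
    (((2 * Real.pi) ^ n * S.det) ^ (-(1 : ℝ) / 2) * Real.exp (-(1 / 2) * q)) with hc
  have hc0 : c ≠ 0 := by
    rw [hc, ne_eq, ENNReal.ofReal_eq_zero, not_le]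
    positivity
  have hin : ∀ x ∈ ellipsoid μ (q • S), c ≤ ENNReal.ofReal (gaussianPdf μ S x) := by
    intro x hx
    rw [hE, Set.mem_ofPred_eq] at hx
    refine ENNReal.ofReal_le_ofReal (mul_le_mul_of_nonneg_left (Real.exp_le_exp.2 ?_) hk.le)
    linarith
  have hout : ∀ x ∉ ellipsoid μ (q • S), ENNReal.ofReal (gaussianPdf μ S x) < c := by
    intro x hx
    rw [hE, Set.mem_ofPred_eq, not_le] at hx
    refine (ENNReal.ofReal_lt_ofReal_iff (by positivity)).2
      (mul_lt_mul_of_pos_left (Real.exp_lt_exp.2 ?_) hk)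
    linarith
  have hfin : gaussianMeasure μ S (ellipsoid μ (q • S)) ≠ ∞ := hmass ▸ ENNReal.ofReal_ne_top
  have hvol : volume (ellipsoid μ (q • S)) ≠ ∞ := by
    have hle : c * volume (ellipsoid μ (q • S)) ≤ ENNReal.ofReal η := by
      rw [← hmass, gaussianMeasure, withDensity_apply _ (hmeas _ _), ← setLIntegral_const]
      exact setLIntegral_mono' (hmeas _ _) hin
    intro htop
    rw [htop, ENNReal.mul_top hc0, top_le_iff] at hle
    exact ENNReal.ofReal_ne_top hle
  refine ⟨hmass.ge, fun μ' C _ hη' => ?_, fun μ' C hC hη' hveq => ?_⟩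
  · exact measure_le_of_measure_sdiff_le (hmeas _ _) (hmeas _ _)
      (measure_le_of_withDensity_le hc0 ENNReal.ofReal_ne_top (hmeas _ _) (hmeas _ _) hin
        (fun x hx => (hout x hx).le) hfin (hmass.le.trans hη')).1
  · obtain ⟨h1, h2⟩ := measure_sdiff_eq_zero_of_withDensity_le hc0 ENNReal.ofReal_ne_top
      (hmeas _ _) (hmeas _ _) hin hout hfin (hmass.le.trans hη') hvol hveq
    have heq : ellipsoid μ (q • S) = ellipsoid μ' C :=
      (subset_of_measure_sdiff_eq_zero (isClosed_ellipsoid _ _)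
        (ellipsoid_subset_closure_interior _ hqS) h1).antisymm
      (subset_of_measure_sdiff_eq_zero (isClosed_ellipsoid _ _)
        (ellipsoid_subset_closure_interior _ hC) h2)
    obtain rfl := ellipsoid_center_injective hqS heq
    exact ⟨rfl, ellipsoid_shape_injective hqS hC heq⟩
end

section
/- Let y ~ N(μ, Σ) with Σ positive definite and η ∈ (0,1). The minimal possible volume of an ellipsoid E containing y with probability at least η equals ω_n · (F^{-1}_{χ²_n}(η))^{n/2} · det(Σ)^{1/2}. -/
open MeasureTheory Matrix ENNReal

/-- `ω_n`, the volume of the Euclidean unit ball in `ℝ^n`. -/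
noncomputable def unitBallVol (n : ℕ) : ℝ≥0∞ :=
  volume (Metric.ball (0 : EuclideanSpace ℝ (Fin n)) 1)

open ProbabilityTheory

/-- The squared Mahalanobis distance `(y - μ)ᵀ S⁻¹ (y - μ)`. -/
noncomputable def mahalanobisSq {n : ℕ} (μ : Fin n → ℝ) (S : Matrix (Fin n) (Fin n) ℝ)
    (y : Fin n → ℝ) : ℝ :=
  (y - μ) ⬝ᵥ (S⁻¹ *ᵥ (y - μ))

theorem measurable_mahalanobisSq {n : ℕ} (μ : Fin n → ℝ) (S : Matrix (Fin n) (Fin n) ℝ) :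
    Measurable (mahalanobisSq μ S) := by
  unfold mahalanobisSq
  exact Continuous.measurable (by fun_prop)

theorem measurableSet_ellipsoid {n : ℕ} (μ : Fin n → ℝ) (C : Matrix (Fin n) (Fin n) ℝ) :
    MeasurableSet (ellipsoid μ C) :=
  measurable_mahalanobisSq μ C measurableSet_Iic

theorem measurable_gaussianPdf {n : ℕ} (μ : Fin n → ℝ) (S : Matrix (Fin n) (Fin n) ℝ) :
    Measurable (gaussianPdf μ S) := by
  have := measurable_mahalanobisSq μ S
  unfold gaussianPdf
  exact ((this.const_mul _).exp).const_mul _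

theorem volume_setOf_dotProduct_self_le_one (n : ℕ) :
    volume {z : Fin n → ℝ | z ⬝ᵥ z ≤ 1} = unitBallVol n := by
  have h : (@WithLp.ofLp 2 (Fin n → ℝ)) ⁻¹' {z : Fin n → ℝ | z ⬝ᵥ z ≤ 1} =
      Metric.closedBall 0 1 := by
    ext x
    rw [mem_closedBall_zero_iff, ← sq_le_one_iff₀ (norm_nonneg x),
      EuclideanSpace.real_norm_sq_eq]
    simp [dotProduct, sq]
  have hm : MeasurableSet {z : Fin n → ℝ | z ⬝ᵥ z ≤ 1} :=
    (isClosed_le (by fun_prop) continuous_const).measurableSet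
  rw [← (PiLp.volume_preserving_ofLp (Fin n)).measure_preimage hm.nullMeasurableSet, h,
    unitBallVol, Measure.addHaar_unitClosedBall_eq_addHaar_unitBall]

open scoped MatrixOrder in
theorem exists_transpose_mul_self_of_posDef {n : ℕ} {C : Matrix (Fin n) (Fin n) ℝ}
    (hC : C.PosDef) : ∃ B : Matrix (Fin n) (Fin n) ℝ, C = Bᵀ * B := by
  obtain ⟨B, hB⟩ := CStarAlgebra.nonneg_iff_eq_star_mul_self.mp hC.posSemidef.nonneg
  exact ⟨B, by simpa [star_eq_conjTranspose] using hB⟩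

theorem volume_ellipsoid {n : ℕ} (μ : Fin n → ℝ) {C : Matrix (Fin n) (Fin n) ℝ}
    (hC : C.PosDef) :
    volume (ellipsoid μ C) = unitBallVol n * ENNReal.ofReal (Real.sqrt C.det) := by
  obtain ⟨B, hB⟩ := exists_transpose_mul_self_of_posDef hC.inv
  have hdet : B.det ^ 2 = C.det⁻¹ := by
    rw [← Ring.inverse_eq_inv, ← det_nonsing_inv, hB, det_mul, det_transpose, sq]
  have hCpos := hC.det_pos
  have hB0 : B.det ≠ 0 := by
    intro h
    rw [h] at hdet
    simp at hdet
    exact hCpos.ne hdet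
  have hset : ellipsoid μ C =
      (fun y => y - μ) ⁻¹' ((toLin' B) ⁻¹' {z : Fin n → ℝ | z ⬝ᵥ z ≤ 1}) := by
    ext y
    simp only [ellipsoid, Set.mem_ofPred_eq, Set.mem_preimage, toLin'_apply, hB]
    rw [← mulVec_mulVec, dotProduct_mulVec, vecMul_transpose]
  have habs : |B.det⁻¹| = Real.sqrt C.det := by
    rw [← Real.sqrt_sq_eq_abs, inv_pow, hdet, inv_inv]
  rw [hset]
  simp_rw [sub_eq_add_neg]
  rw [measure_preimage_add_right, Measure.addHaar_preimage_linearMap _ (by simpa using hB0),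
    LinearMap.det_toLin', habs, volume_setOf_dotProduct_self_le_one, mul_comm]

theorem unitBallVol_eq_ofReal {n : ℕ} (hn : 0 < n) :
    unitBallVol n = ENNReal.ofReal (Real.sqrt Real.pi ^ n / Real.Gamma ((n : ℝ) / 2 + 1)) := by
  have : Nonempty (Fin n) := Fin.pos_iff_nonempty.mp hn
  simp [unitBallVol, EuclideanSpace.volume_ball]

theorem setOf_mahalanobisSq_le_eq_ellipsoid {n : ℕ} (μ : Fin n → ℝ)
    {S : Matrix (Fin n) (Fin n) ℝ} (hS : S.PosDef) {t : ℝ} (ht : 0 < t) :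
    {y | mahalanobisSq μ S y ≤ t} = ellipsoid μ (t • S) := by
  have hinv : (t • S)⁻¹ = t⁻¹ • S⁻¹ := by
    have := Matrix.inv_smul' S (Units.mk0 t ht.ne') hS.det_pos.ne'.isUnit
    simpa [Units.smul_def] using this
  ext y
  simp only [mahalanobisSq, ellipsoid, Set.mem_ofPred_eq, hinv, smul_mulVec, dotProduct_smul,
    smul_eq_mul]
  rw [inv_mul_le_iff₀ ht, mul_one]

theorem volume_setOf_mahalanobisSq_le {n : ℕ} (hn : 0 < n) (μ : Fin n → ℝ)
    {S : Matrix (Fin n) (Fin n) ℝ} (hS : S.PosDef) (t : ℝ) :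
    volume {y | mahalanobisSq μ S y ≤ t} =
      ENNReal.ofReal (Real.sqrt Real.pi ^ n / Real.Gamma ((n : ℝ) / 2 + 1) * Real.sqrt S.det *
        max t 0 ^ ((n : ℝ) / 2)) := by
  have hp : 0 < (n : ℝ) / 2 := by positivity
  rcases lt_or_ge 0 t with ht | ht
  · rw [setOf_mahalanobisSq_le_eq_ellipsoid μ hS ht, volume_ellipsoid μ (hS.smul ht),
      unitBallVol_eq_ofReal hn, ← ENNReal.ofReal_mul (by positivity), max_eq_left ht.le, det_smul,
      Fintype.card_fin, Real.sqrt_mul (by positivity), Real.sqrt_eq_rpow (t ^ n),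
      ← Real.rpow_natCast t n, ← Real.rpow_mul ht.le]
    congr 1
    rw [mul_one_div]
    ring
  · have hsub : {y | mahalanobisSq μ S y ≤ t} ⊆ {μ} := by
      intro y hy
      by_contra hne
      have := hS.inv.dotProduct_mulVec_pos (sub_ne_zero.2 hne)
      simp only [star_trivial] at this
      exact absurd (le_trans hy ht) (not_le.2 this)
    have : Nonempty (Fin n) := Fin.pos_iff_nonempty.mp hn
    rw [max_eq_right ht, Real.zero_rpow hp.ne', mul_zero, ENNReal.ofReal_zero]
    exact measure_mono_null hsub (measure_singleton μ)

theorem setLIntegral_Iic_rpow {c p : ℝ} (hc : 0 ≤ c) (hp : 0 < p) (t : ℝ) :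
    ∫⁻ s in Set.Iic t, ENNReal.ofReal (if 0 ≤ s then c * p * s ^ (p - 1) else 0) =
      ENNReal.ofReal (c * max t 0 ^ p) := by
  have hind : ∀ s : ℝ, ENNReal.ofReal (if 0 ≤ s then c * p * s ^ (p - 1) else 0) =
      (Set.Ici (0 : ℝ)).indicator (fun s => ENNReal.ofReal (c * p * s ^ (p - 1))) s := by
    intro s
    by_cases hs : 0 ≤ s <;> simp [hs]
  simp_rw [hind]
  rw [setLIntegral_indicator measurableSet_Ici, Set.Ici_inter_Iic]
  rcases lt_or_ge t 0 with ht | ht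
  · rw [Set.Icc_eq_empty (not_le.2 ht), max_eq_right ht.le, Real.zero_rpow hp.ne']
    simp
  have hint : IntervalIntegrable (fun s : ℝ => c * p * s ^ (p - 1)) volume 0 t :=
    (intervalIntegral.intervalIntegrable_rpow' (by linarith)).const_mul _
  rw [setLIntegral_congr (Ioc_ae_eq_Icc (μ := volume)).symm,
    ← ofReal_integral_eq_lintegral_ofReal, ← intervalIntegral.integral_of_le ht,
    intervalIntegral.integral_const_mul, integral_rpow (Or.inl (by linarith))]
  · congr 1
    rw [sub_add_cancel, Real.zero_rpow hp.ne', max_eq_left ht]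
    field_simp
    ring
  · exact (intervalIntegrable_iff_integrableOn_Ioc_of_le ht).1 hint
  · filter_upwards [ae_restrict_mem measurableSet_Ioc] with s hs
    have := hs.1.le
    exact mul_nonneg (mul_nonneg hc hp.le) (Real.rpow_nonneg this _)

theorem measure_eq_of_forall_Iic_eq {ν τ : Measure ℝ} (hν : ∀ t, ν (Set.Iic t) ≠ ∞)
    (h : ∀ t, ν (Set.Iic t) = τ (Set.Iic t)) : ν = τ := by
  refine Measure.ext_of_Ioc' ν τ
    (fun a b _ => measure_ne_top_of_subset Set.Ioc_subset_Iic_self (hν b)) fun a b hab => ?_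
  rw [← Set.Iic_sdiff_Iic, measure_sdiff (Set.Iic_subset_Iic.2 hab.le)
    measurableSet_Iic.nullMeasurableSet (hν a), measure_sdiff (Set.Iic_subset_Iic.2 hab.le)
    measurableSet_Iic.nullMeasurableSet (h a ▸ hν a), h, h]

theorem map_mahalanobisSq_volume {n : ℕ} (hn : 0 < n) (μ : Fin n → ℝ)
    {S : Matrix (Fin n) (Fin n) ℝ} (hS : S.PosDef) :
    Measure.map (mahalanobisSq μ S) volume = volume.withDensity fun s =>
      ENNReal.ofReal (if 0 ≤ s then
        Real.sqrt Real.pi ^ n / Real.Gamma ((n : ℝ) / 2 + 1) * Real.sqrt S.det * ((n : ℝ) / 2) *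
          s ^ ((n : ℝ) / 2 - 1) else 0) := by
  have hmap : ∀ t, Measure.map (mahalanobisSq μ S) volume (Set.Iic t) = _ := fun t =>
    (Measure.map_apply (measurable_mahalanobisSq μ S) measurableSet_Iic).trans
      (volume_setOf_mahalanobisSq_le hn μ hS t)
  refine measure_eq_of_forall_Iic_eq (fun t => by rw [hmap]; exact ENNReal.ofReal_ne_top)
    fun t => ?_
  rw [hmap, withDensity_apply _ measurableSet_Iic, setLIntegral_Iic_rpow _ (by positivity)]
  have := Real.Gamma_pos_of_pos (show 0 < (n : ℝ) / 2 + 1 by positivity)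
  positivity

theorem chiSquare_normalization {n : ℕ} (hn : 0 < n) {d : ℝ} (hd : 0 < d) :
    Real.sqrt Real.pi ^ n / Real.Gamma ((n : ℝ) / 2 + 1) * Real.sqrt d * ((n : ℝ) / 2) *
        ((2 * Real.pi) ^ n * d) ^ (-(1 : ℝ) / 2) =
      (1 / 2 : ℝ) ^ ((n : ℝ) / 2) / Real.Gamma ((n : ℝ) / 2) := by
  have hp : 0 < (n : ℝ) / 2 := by positivity
  have hG := Real.Gamma_pos_of_pos hp
  have hpi := Real.pi_pos
  have hsqrt : ∀ {a : ℝ}, 0 ≤ a → Real.sqrt (a ^ n) = Real.sqrt a ^ n := fun {a} ha => by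
    rw [← Real.sqrt_sq (pow_nonneg (Real.sqrt_nonneg a) n), ← pow_mul, mul_comm n, pow_mul,
      Real.sq_sqrt ha]
  have hpow : ((2 * Real.pi) ^ n * d) ^ (-(1 : ℝ) / 2) =
      (Real.sqrt 2 ^ n * Real.sqrt Real.pi ^ n * Real.sqrt d)⁻¹ := by
    rw [neg_div, Real.rpow_neg (by positivity), ← Real.sqrt_eq_rpow, Real.sqrt_mul (by positivity),
      mul_pow, Real.sqrt_mul (by positivity), hsqrt zero_le_two, hsqrt hpi.le]
  have hhalf : (1 / 2 : ℝ) ^ ((n : ℝ) / 2) = (Real.sqrt 2 ^ n)⁻¹ := by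
    rw [one_div, Real.inv_rpow (by norm_num), Real.sqrt_eq_rpow, ← Real.rpow_natCast,
      ← Real.rpow_mul (by norm_num)]
    congr 2
    ring
  have hsd := Real.sqrt_pos.2 hd
  rw [hpow, hhalf, Real.Gamma_add_one hp.ne']
  field_simp

theorem gaussianMeasure_setOf_mahalanobisSq_le {n : ℕ} (hn : 0 < n) (μ : Fin n → ℝ)
    {S : Matrix (Fin n) (Fin n) ℝ} (hS : S.PosDef) (t : ℝ) :
    gaussianMeasure μ S {y | mahalanobisSq μ S y ≤ t} = chiSquareMeasure n (Set.Iic t) := by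
  have hQ := measurable_mahalanobisSq μ S
  have hdet := hS.det_pos
  have hG := Real.Gamma_pos_of_pos (show 0 < (n : ℝ) / 2 + 1 by positivity)
  have hf : Measurable fun s : ℝ => ENNReal.ofReal
      (((2 * Real.pi) ^ n * S.det) ^ (-(1 : ℝ) / 2) * Real.exp (-(1 / 2) * s)) := by fun_prop
  have hset : MeasurableSet {y | mahalanobisSq μ S y ≤ t} := hQ measurableSet_Iic
  have hmap := setLIntegral_map (μ := volume) (measurableSet_Iic (a := t)) hf hQ
  rw [gaussianMeasure, withDensity_apply _ hset, chiSquareMeasure, gammaMeasure,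
    withDensity_apply _ measurableSet_Iic]
  refine hmap.symm.trans ?_
  rw [map_mahalanobisSq_volume hn μ hS, restrict_withDensity measurableSet_Iic,
    lintegral_withDensity_eq_lintegral_mul _ _ hf]
  · refine lintegral_congr fun s => ?_
    rw [gammaPDF_eq, Pi.mul_apply]
    by_cases hs : 0 ≤ s
    · rw [if_pos hs, if_pos hs, ← ENNReal.ofReal_mul (by positivity),
        ← chiSquare_normalization hn hdet]
      congr 1
      rw [neg_mul]
      ring
    · simp [hs]
  · exact ENNReal.measurable_ofReal.comp
      (Measurable.ite measurableSet_Ici (by fun_prop) measurable_const)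

/-- Among sets of a given finite measure, superlevel sets of `f` maximize the integral of `f`. -/
theorem withDensity_le_withDensity_of_superlevel {α : Type*} [MeasurableSpace α] {ν : Measure α}
    {f : α → ℝ≥0∞} {c : ℝ≥0∞} {A B : Set α} (hA : MeasurableSet A) (hB : MeasurableSet B)
    (hAB : ν A = ν B) (hfin : ν A ≠ ∞) (hout : ∀ x, x ∉ B → f x ≤ c) (hin : ∀ x ∈ B, c ≤ f x) :
    ν.withDensity f A ≤ ν.withDensity f B := by
  have hdiff : ν (A \ B) = ν (B \ A) := by
    have h1 := measure_sdiff_add_inter (μ := ν) A hB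
    have h2 := measure_sdiff_add_inter (μ := ν) B hA
    rw [Set.inter_comm, ← hAB, ← h1] at h2
    exact ((ENNReal.add_left_inj
      (measure_ne_top_of_subset Set.inter_subset_left hfin)).1 h2).symm
  rw [← measure_sdiff_add_inter (μ := ν.withDensity f) A hB,
    ← measure_sdiff_add_inter (μ := ν.withDensity f) B hA, Set.inter_comm B A]
  gcongr 1
  rw [withDensity_apply _ (hA.diff hB), withDensity_apply _ (hB.diff hA)]
  calc ∫⁻ x in A \ B, f x ∂ν ≤ ∫⁻ _ in A \ B, c ∂ν :=
        setLIntegral_mono measurable_const fun x hx => hout x hx.2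
    _ = ∫⁻ _ in B \ A, c ∂ν := by rw [setLIntegral_const, setLIntegral_const, hdiff]
    _ ≤ ∫⁻ x in B \ A, f x ∂ν := setLIntegral_mono' (hB.diff hA) fun x hx => hin x hx.1

theorem gaussianMeasure_le_of_volume_eq {n : ℕ} (μ : Fin n → ℝ)
    {S : Matrix (Fin n) (Fin n) ℝ} (hS : S.PosDef) {A : Set (Fin n → ℝ)} (hA : MeasurableSet A)
    (hfin : volume A ≠ ∞) {t : ℝ} (hvol : volume A = volume {y | mahalanobisSq μ S y ≤ t}) :
    gaussianMeasure μ S A ≤ gaussianMeasure μ S {y | mahalanobisSq μ S y ≤ t} := by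
  have hdet := hS.det_pos
  refine withDensity_le_withDensity_of_superlevel (c := ENNReal.ofReal
    (((2 * Real.pi) ^ n * S.det) ^ (-(1 : ℝ) / 2) * Real.exp (-(1 / 2) * t))) hA
    (measurable_mahalanobisSq μ S measurableSet_Iic) hvol hfin (fun y hy => ?_) fun y hy => ?_
  · have hy' : t < (y - μ) ⬝ᵥ (S⁻¹ *ᵥ (y - μ)) := not_le.1 hy
    unfold gaussianPdf
    gcongr ENNReal.ofReal (_ * Real.exp ?_)
    linarith
  · have hy' : (y - μ) ⬝ᵥ (S⁻¹ *ᵥ (y - μ)) ≤ t := hy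
    unfold gaussianPdf
    gcongr ENNReal.ofReal (_ * Real.exp ?_)
    linarith

theorem isProbabilityMeasure_chiSquareMeasure {n : ℕ} (hn : 0 < n) :
    IsProbabilityMeasure (chiSquareMeasure n) :=
  isProbabilityMeasure_gammaMeasure (by positivity) (by norm_num)

theorem chiSquareCDF_eq_cdf {n : ℕ} (hn : 0 < n) (t : ℝ) :
    chiSquareCDF n t = cdf (chiSquareMeasure n) t := by
  have := isProbabilityMeasure_chiSquareMeasure hn
  rw [cdf_eq_real]
  rfl

theorem chiSquareCDF_of_nonpos {n : ℕ} {t : ℝ} (ht : t ≤ 0) : chiSquareCDF n t = 0 := by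
  rw [chiSquareCDF, chiSquareMeasure, gammaMeasure, withDensity_apply _ measurableSet_Iic,
    setLIntegral_congr Iio_ae_eq_Iic.symm, lintegral_gammaPDF_of_nonpos ht, ENNReal.toReal_zero]

theorem pos_of_le_chiSquareCDF {n : ℕ} {η t : ℝ} (hη : 0 < η) (ht : η ≤ chiSquareCDF n t) :
    0 < t := by
  by_contra! h
  rw [chiSquareCDF_of_nonpos h] at ht
  exact ht.not_gt hη

theorem chiSquareCDF_lt_of_lt_quantile {n : ℕ} {η t : ℝ} (hη : 0 < η)
    (ht : t < chiSquareQuantile n η) : chiSquareCDF n t < η := by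
  by_contra! h
  exact ht.not_ge (csInf_le ⟨0, fun s hs => (pos_of_le_chiSquareCDF hη hs).le⟩ h)

theorem le_chiSquareCDF_quantile {n : ℕ} (hn : 0 < n) {η : ℝ} (hη : η ∈ Set.Ioo (0 : ℝ) 1) :
    η ≤ chiSquareCDF n (chiSquareQuantile n η) := by
  have hne : {t : ℝ | η ≤ chiSquareCDF n t}.Nonempty := by
    obtain ⟨t, ht⟩ := ((tendsto_cdf_atTop (chiSquareMeasure n)).eventually_const_le hη.2).exists
    exact ⟨t, by rwa [Set.mem_ofPred_eq, chiSquareCDF_eq_cdf hn]⟩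
  rw [chiSquareCDF_eq_cdf hn]
  have hcont := (cdf (chiSquareMeasure n)).right_continuous (chiSquareQuantile n η)
  refine ge_of_tendsto (hcont.mono_left (nhdsWithin_mono _ Set.Ioi_subset_Ici_self)) ?_
  filter_upwards [self_mem_nhdsWithin] with t ht
  obtain ⟨s, hs, hst⟩ := exists_lt_of_csInf_lt hne ht
  rw [Set.mem_ofPred_eq, chiSquareCDF_eq_cdf hn] at hs
  exact hs.trans (monotone_cdf _ hst.le)

theorem gaussianMeasure_ellipsoid_of_dim_zero (μ μ' : Fin 0 → ℝ)
    (S C : Matrix (Fin 0) (Fin 0) ℝ) : gaussianMeasure μ S (ellipsoid μ' C) = 1 := by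
  have hset : ellipsoid μ' C = Set.univ := by
    ext y
    simp [ellipsoid]
  have hpdf : gaussianPdf μ S = fun _ => 1 := by
    ext y
    simp [gaussianPdf]
  rw [gaussianMeasure, hset, hpdf]
  simp [Measure.volume_pi_eq_dirac 0]

theorem chiSquareQuantile_rpow_mul_sqrt_le_of_coverage {n : ℕ} (hn : 0 < n) (μ μ' : Fin n → ℝ)
    {S C : Matrix (Fin n) (Fin n) ℝ} (hS : S.PosDef) (hC : C.PosDef) {η : ℝ} (hη : 0 < η)
    (hcov : ENNReal.ofReal η ≤ gaussianMeasure μ S (ellipsoid μ' C)) :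
    chiSquareQuantile n η ^ ((n : ℝ) / 2) * Real.sqrt S.det ≤ Real.sqrt C.det := by
  have hp : 0 < (n : ℝ) / 2 := by positivity
  have hSd := hS.det_pos
  have hCd := hC.det_pos
  by_contra! hlt
  set t : ℝ := (C.det / S.det) ^ ((n : ℝ)⁻¹) with ht_def
  have ht : 0 < t := by positivity
  have htn : t ^ n * S.det = C.det := by
    rw [ht_def, Real.rpow_inv_natCast_pow (by positivity) hn.ne']
    field_simp
  have htp : t ^ ((n : ℝ) / 2) * Real.sqrt S.det = Real.sqrt C.det := by
    rw [← htn, Real.sqrt_mul (by positivity), Real.sqrt_eq_rpow (t ^ n), ← Real.rpow_natCast t n,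
      ← Real.rpow_mul ht.le, mul_one_div]
  have hlt_quantile : t < chiSquareQuantile n η := by
    have hq : 0 ≤ chiSquareQuantile n η :=
      Real.sInf_nonneg fun s hs => (pos_of_le_chiSquareCDF hη hs).le
    rw [← htp] at hlt
    exact (Real.rpow_lt_rpow_iff ht.le hq hp).1
      (lt_of_mul_lt_mul_right hlt (Real.sqrt_nonneg _))
  have hvol : volume (ellipsoid μ' C) = volume {y | mahalanobisSq μ S y ≤ t} := by
    rw [setOf_mahalanobisSq_le_eq_ellipsoid μ hS ht, volume_ellipsoid _ hC,
      volume_ellipsoid _ (hS.smul ht), det_smul, Fintype.card_fin, htn]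
  have hfin : volume (ellipsoid μ' C) ≠ ∞ := by
    rw [volume_ellipsoid _ hC, unitBallVol_eq_ofReal hn]
    exact ENNReal.mul_ne_top ENNReal.ofReal_ne_top ENNReal.ofReal_ne_top
  have hle := hcov.trans
    (gaussianMeasure_le_of_volume_eq μ hS (measurableSet_ellipsoid μ' C) hfin hvol)
  have := isProbabilityMeasure_chiSquareMeasure hn
  rw [gaussianMeasure_setOf_mahalanobisSq_le hn μ hS,
    ENNReal.ofReal_le_iff_le_toReal (measure_ne_top _ _)] at hle
  exact hle.not_gt (chiSquareCDF_lt_of_lt_quantile hη hlt_quantile)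

/-- For `y ~ N(μ, S)` with `S` positive definite and `η ∈ (0,1)`, the minimal possible
volume of an ellipsoid covering `y` with probability at least `η` equals
`ω_n · (F⁻¹_{χ²_n}(η))^{n/2} · det(S)^{1/2}`. -/
theorem minimal_coverage_ellipsoid_volume {n : ℕ} (μ : Fin n → ℝ)
    (S : Matrix (Fin n) (Fin n) ℝ) (hS : S.PosDef) (η : ℝ) (hη : η ∈ Set.Ioo (0 : ℝ) 1) :
    IsLeast
      {V : ℝ≥0∞ | ∃ (μ' : Fin n → ℝ) (C : Matrix (Fin n) (Fin n) ℝ), C.PosDef ∧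
        ENNReal.ofReal η ≤ gaussianMeasure μ S (ellipsoid μ' C) ∧
        V = volume (ellipsoid μ' C)}
      (unitBallVol n *
        ENNReal.ofReal (chiSquareQuantile n η ^ ((n : ℝ) / 2) * Real.sqrt S.det)) := by
  rcases Nat.eq_zero_or_pos n with rfl | hn
  · constructor
    · refine ⟨μ, S, hS, ?_, ?_⟩
      · rw [gaussianMeasure_ellipsoid_of_dim_zero]
        exact ENNReal.ofReal_le_one.2 hη.2.le
      · rw [volume_ellipsoid μ hS]
        simp
    · rintro V ⟨μ', C, hC, -, rfl⟩
      rw [volume_ellipsoid μ' hC]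
      simp
  · constructor
    · have hcdf := le_chiSquareCDF_quantile hn hη
      have hq := pos_of_le_chiSquareCDF hη.1 hcdf
      have := isProbabilityMeasure_chiSquareMeasure hn
      refine ⟨μ, chiSquareQuantile n η • S, hS.smul hq, ?_, ?_⟩
      · rw [← setOf_mahalanobisSq_le_eq_ellipsoid μ hS hq,
          gaussianMeasure_setOf_mahalanobisSq_le hn μ hS,
          ENNReal.ofReal_le_iff_le_toReal (measure_ne_top _ _)]
        exact hcdf
      · rw [volume_ellipsoid μ (hS.smul hq), det_smul, Fintype.card_fin,
          Real.sqrt_mul (by positivity), Real.sqrt_eq_rpow (_ ^ n),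
          ← Real.rpow_natCast _ n, ← Real.rpow_mul hq.le, mul_one_div]
    · rintro V ⟨μ', C, hC, hcov, rfl⟩
      rw [volume_ellipsoid μ' hC]
      gcongr
      exact chiSquareQuantile_rpow_mul_sqrt_le_of_coverage hn μ μ' hS hC hη.1 hcov
end
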